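/- Let K be a field, let S be the monoid presented by ⟨a, b ∣ ba²b = a², a⁴b = ba⁴⟩, and let R = K[S] be the semigroup (monoid) algebra of S over K. Then: (1) R is a domain; (2) R is atomic, i.e., every nonzero nonunit of R is a finite product of atoms of R; (3) R does not satisfy the ascending chain condition on principal right ideals — in fact a²R ⊊ ba²R ⊊ b²a²R ⊊ ⋯ ⊊ b^k a² R ⊊ ⋯ is a strictly ascending chain of principal right ideals — and likewise R does not satisfy the ascending chain condition on principal left ideals; in particular, R is not a BF-domain (for instance a² = b^n a² b^n for all n ≥ 0, so the length set of a² is infinite). -/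

import Mathlib

/-- An element `c` of a monoid is *cancellative* if it can be cancelled on both sides. -/
def IsCancellative {R : Type*} [Monoid R] (c : R) : Prop :=
  (∀ x y : R, c * x = c * y → x = y) ∧ (∀ x y : R, x * c = y * c → x = y)

/-- The submonoid of cancellative elements of a monoid. -/
def cancellativeSubmonoid (R : Type*) [Monoid R] : Submonoid R where
  carrier := {c | IsCancellative c}
  one_mem' := ⟨fun x y h => by simpa using h, fun x y h => by simpa using h⟩
  mul_mem' := by
    rintro a b ⟨hal, har⟩ ⟨hbl, hbr⟩
    constructor
    · intro x y h
      exact hbl x y (hal (b * x) (b * y) (by rw [← mul_assoc, ← mul_assoc]; exact h))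
    · intro x y h
      exact har x y (hbr (x * a) (y * a) (by rw [mul_assoc, mul_assoc]; exact h))

/-- The set of lengths of factorizations of `a` into atoms (irreducible elements). -/
def mulLengthSet {H : Type*} [Monoid H] (a : H) : Set ℕ :=
  {k | ∃ l : List H, (∀ x ∈ l, Irreducible x) ∧ l.prod = a ∧ l.length = k}

/-- A monoid is *atomic* if every nonunit is a finite product of atoms. -/
def IsAtomicMonoid (H : Type*) [Monoid H] : Prop :=
  ∀ a : H, ¬ IsUnit a → ∃ l : List H, (∀ x ∈ l, Irreducible x) ∧ l.prod = a

/-- A monoid is a *BF-monoid* if it is atomic and all length sets are finite. -/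
def IsBFMonoid (H : Type*) [Monoid H] : Prop :=
  IsAtomicMonoid H ∧ ∀ a : H, (mulLengthSet a).Finite

/-- A ring is a *BF-ring* if its monoid of cancellative elements is a BF-monoid. -/
def IsBFRing (R : Type*) [Ring R] : Prop :=
  IsBFMonoid (cancellativeSubmonoid R)

namespace PaperExample

/-- The defining relations of the presented monoid
`⟨a, b ∣ ba²b = a², a⁴b = ba⁴⟩`, on the free monoid on two generators where
`false` stands for `a` and `true` stands for `b`. -/
def presRel : FreeMonoid Bool → FreeMonoid Bool → Prop := fun x y =>
  (x = FreeMonoid.of true * FreeMonoid.of false ^ 2 * FreeMonoid.of true ∧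
    y = FreeMonoid.of false ^ 2) ∨
  (x = FreeMonoid.of false ^ 4 * FreeMonoid.of true ∧
    y = FreeMonoid.of true * FreeMonoid.of false ^ 4)

/-- The congruence on the free monoid generated by the relations
`ba²b = a²` and `a⁴b = ba⁴`. -/
def presCon : Con (FreeMonoid Bool) := conGen presRel

/-- The monoid `S` presented by `⟨a, b ∣ ba²b = a², a⁴b = ba⁴⟩`. -/
abbrev PresentedS : Type := presCon.Quotient

/-- The generator `a` of `S`. -/
def sA : PresentedS := presCon.mk' (FreeMonoid.of false)

/-- The generator `b` of `S`. -/
def sB : PresentedS := presCon.mk' (FreeMonoid.of true)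

/-- The image of the generator `a` in the monoid algebra `K[S]`. -/
noncomputable def eA (K : Type*) [Field K] : MonoidAlgebra K PresentedS :=
  MonoidAlgebra.of K PresentedS sA

/-- The image of the generator `b` in the monoid algebra `K[S]`. -/
noncomputable def eB (K : Type*) [Field K] : MonoidAlgebra K PresentedS :=
  MonoidAlgebra.of K PresentedS sB

/-! ### Basic facts on the monoid -/

theorem s_rel : sB * sA ^ 2 * sB = sA ^ 2 := by
  have h : presCon (FreeMonoid.of true * FreeMonoid.of false ^ 2 * FreeMonoid.of true)
      (FreeMonoid.of false ^ 2) := ConGen.Rel.of _ _ (Or.inl ⟨rfl, rfl⟩)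
  have := (Con.eq presCon).2 h
  exact this

theorem s_rel2 : sA ^ 4 * sB = sB * sA ^ 4 := by
  have h : presCon (FreeMonoid.of false ^ 4 * FreeMonoid.of true)
      (FreeMonoid.of true * FreeMonoid.of false ^ 4) := ConGen.Rel.of _ _ (Or.inr ⟨rfl, rfl⟩)
  have := (Con.eq presCon).2 h
  exact this

/-- Universal property of the presented monoid. -/
def sLift {M : Type*} [Monoid M] (x y : M) (h1 : y * x ^ 2 * y = x ^ 2)
    (h2 : x ^ 4 * y = y * x ^ 4) : PresentedS →* M :=
  presCon.lift (FreeMonoid.lift (fun t : Bool => if t then y else x)) (by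
    refine Con.conGen_le.2 ?_
    rintro u v (⟨rfl, rfl⟩ | ⟨rfl, rfl⟩)
    · simp [Con.ker_rel, h1]
    · simp [Con.ker_rel, h2])

theorem sLift_A {M : Type*} [Monoid M] (x y : M) (h1 : y * x ^ 2 * y = x ^ 2)
    (h2 : x ^ 4 * y = y * x ^ 4) : sLift x y h1 h2 sA = x := by
  have : sLift x y h1 h2 sA =
      FreeMonoid.lift (fun t : Bool => if t then y else x) (FreeMonoid.of false) := rfl
  rw [this, FreeMonoid.lift_eval_of]
  simp

theorem sLift_B {M : Type*} [Monoid M] (x y : M) (h1 : y * x ^ 2 * y = x ^ 2)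
    (h2 : x ^ 4 * y = y * x ^ 4) : sLift x y h1 h2 sB = y := by
  have : sLift x y h1 h2 sB =
      FreeMonoid.lift (fun t : Bool => if t then y else x) (FreeMonoid.of true) := rfl
  rw [this, FreeMonoid.lift_eval_of]
  simp

theorem s_ind {P : PresentedS → Prop} (h1 : P 1) (hA : ∀ s, P s → P (sA * s))
    (hB : ∀ s, P s → P (sB * s)) (s : PresentedS) : P s := by
  induction s using Con.induction_on with
  | H w =>
    induction w using FreeMonoid.inductionOn' with
    | one => exact h1
    | of_mul t w ih =>
      cases t
      · exact hA _ ih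
      · exact hB _ ih

theorem s_A4_comm (s : PresentedS) : sA ^ 4 * s = s * sA ^ 4 := by
  induction s using s_ind with
  | h1 => simp
  | hA s ih => rw [← mul_assoc, ← pow_succ, pow_succ', mul_assoc, ih, mul_assoc]
  | hB s ih => rw [← mul_assoc, s_rel2, mul_assoc, ih, mul_assoc]

theorem s_pow_rel (n : ℕ) : sA ^ 2 = sB ^ n * sA ^ 2 * sB ^ n := by
  induction n with
  | zero => simp
  | succ n ih =>
    calc sA ^ 2 = sB ^ n * sA ^ 2 * sB ^ n := ih
      _ = sB ^ n * (sB * sA ^ 2 * sB) * sB ^ n := by rw [s_rel]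
      _ = (sB ^ n * sB) * sA ^ 2 * (sB * sB ^ n) := by simp only [mul_assoc]
      _ = _ := by rw [← pow_succ, ← pow_succ']

/-! ### Action on the rational line -/

/-- The piecewise linear map by which `b` acts. -/
def bfun (q : ℚ) : ℚ :=
  4 * (⌊(q + 1) / 4⌋ : ℤ) + (if q - 4 * (⌊(q + 1) / 4⌋ : ℤ) < 2
    then (q - 4 * (⌊(q + 1) / 4⌋ : ℤ) + 1) / 3 else 3 * (q - 4 * (⌊(q + 1) / 4⌋ : ℤ)) - 5)

theorem bfun_lo (q : ℚ) (m : ℤ) (h1 : -1 ≤ q - 4 * m) (h2 : q - 4 * m < 2) :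
    bfun q = 4 * m + (q - 4 * m + 1) / 3 := by
  have : ⌊(q + 1) / 4⌋ = m := by rw [Int.floor_eq_iff]; constructor <;> linarith
  unfold bfun
  rw [this, if_pos h2]

theorem bfun_hi (q : ℚ) (m : ℤ) (h1 : 2 ≤ q - 4 * m) (h2 : q - 4 * m < 3) :
    bfun q = 4 * m + (3 * (q - 4 * m) - 5) := by
  have : ⌊(q + 1) / 4⌋ = m := by rw [Int.floor_eq_iff]; constructor <;> linarith
  unfold bfun
  rw [this, if_neg (not_lt.2 h1)]

theorem b_cases (q : ℚ) : ∃ m : ℤ, (-1 ≤ q - 4 * m ∧ q - 4 * m < 2) ∨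
    (2 ≤ q - 4 * m ∧ q - 4 * m < 3) := by
  refine ⟨⌊(q + 1) / 4⌋, ?_⟩
  have h1 := Int.floor_le ((q + 1) / 4)
  have h2 := Int.lt_floor_add_one ((q + 1) / 4)
  rcases lt_or_ge (q - 4 * (⌊(q + 1) / 4⌋ : ℤ)) 2 with h | h
  · left; constructor <;> linarith
  · right; constructor <;> linarith

theorem bfun_bfun (q : ℚ) : bfun (bfun q + 2) = q + 2 := by
  obtain ⟨m, ⟨h1, h2⟩ | ⟨h1, h2⟩⟩ := b_cases q
  · rw [bfun_lo q m h1 h2, bfun_hi _ m (by linarith) (by linarith)]; ring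
  · rw [bfun_hi q m h1 h2, bfun_lo _ (m + 1) (by push_cast; linarith) (by push_cast; linarith)]
    push_cast; ring

theorem bfun_strictMono : StrictMono bfun := by
  intro x y hxy
  obtain ⟨m, hm⟩ := b_cases x
  obtain ⟨n, hn⟩ := b_cases y
  have hmn : m ≤ n := by
    by_contra hc
    have : (n : ℚ) + 1 ≤ m := by exact_mod_cast (not_le.1 hc)
    rcases hm with hm | hm <;> rcases hn with hn | hn <;> linarith
  rcases hmn.eq_or_lt with rfl | hlt
  · rcases hm with ⟨h1, h2⟩ | ⟨h1, h2⟩ <;> rcases hn with ⟨h3, h4⟩ | ⟨h3, h4⟩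
    · rw [bfun_lo x m h1 h2, bfun_lo y m h3 h4]; linarith
    · rw [bfun_lo x m h1 h2, bfun_hi y m h3 h4]; linarith
    · linarith
    · rw [bfun_hi x m h1 h2, bfun_hi y m h3 h4]; linarith
  · have : (m : ℚ) + 1 ≤ n := by exact_mod_cast hlt
    rcases hm with ⟨h1, h2⟩ | ⟨h1, h2⟩ <;> rcases hn with ⟨h3, h4⟩ | ⟨h3, h4⟩
    · rw [bfun_lo x m h1 h2, bfun_lo y n h3 h4]; linarith
    · rw [bfun_lo x m h1 h2, bfun_hi y n h3 h4]; linarith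
    · rw [bfun_hi x m h1 h2, bfun_lo y n h3 h4]; linarith
    · rw [bfun_hi x m h1 h2, bfun_hi y n h3 h4]; linarith

/-- The permutation by which `b` acts. -/
def bPerm : Equiv.Perm ℚ where
  toFun := bfun
  invFun q := bfun (q + 2) - 2
  left_inv q := by
    change bfun (bfun q + 2) - 2 = q
    rw [bfun_bfun]; ring
  right_inv q := by
    have : bfun (bfun (bfun (q + 2) - 2) + 2) = bfun (q + 2) := by
      rw [bfun_bfun]; ring
    have := bfun_strictMono.injective this
    linarith

theorem addRight_pow_apply (n : ℕ) (q : ℚ) : (Equiv.addRight (1 : ℚ) ^ n) q = q + n := by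
  induction n with
  | zero => simp
  | succ n ih => rw [pow_succ', Equiv.Perm.mul_apply, ih]; simp; ring

theorem bfun_add_four (q : ℚ) : bfun (q + 4) = bfun q + 4 := by
  have h := bfun_bfun (bfun q + 2)
  rw [bfun_bfun q] at h
  rw [show q + 4 = q + 2 + 2 by ring, h]; ring

/-- The action of the monoid on the rational line. -/
def sAct : PresentedS →* Equiv.Perm ℚ :=
  sLift (Equiv.addRight (1 : ℚ)) bPerm
    (by
      ext q
      simp only [Equiv.Perm.mul_apply, addRight_pow_apply]
      exact_mod_cast bfun_bfun q)
    (by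
      ext q
      simp only [Equiv.Perm.mul_apply, addRight_pow_apply]
      exact_mod_cast (bfun_add_four q).symm)

theorem sAct_A (n : ℕ) (q : ℚ) : sAct (sA ^ n) q = q + n := by
  rw [map_pow, sAct, sLift_A, addRight_pow_apply]

theorem sAct_B (q : ℚ) : sAct sB q = bfun q := by
  rw [sAct, sLift_B]; rfl

theorem sAct_strictMono (s : PresentedS) : StrictMono (sAct s) := by
  induction s using s_ind with
  | h1 => rw [map_one]; exact strictMono_id
  | hA s ih =>
    intro x y h
    have := ih h
    rw [map_mul, Equiv.Perm.mul_apply, Equiv.Perm.mul_apply]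
    have h2 := sAct_A 1
    rw [pow_one] at h2
    rw [h2, h2]; linarith
  | hB s ih =>
    intro x y h
    rw [map_mul, Equiv.Perm.mul_apply, Equiv.Perm.mul_apply, sAct_B, sAct_B]
    exact bfun_strictMono (ih h)

/-! ### Normal forms -/

/-- The word `a^e₀ b a^e₁ b ⋯`. -/
def nfW : List ℕ → PresentedS
  | [] => 1
  | e :: E => sA ^ e * sB * nfW E

/-- Allowed inner exponents. -/
def Inner (E : List ℕ) : Prop := ∀ e ∈ E, e = 0 ∨ e = 1 ∨ e = 3

/-- Normal words. -/
def NValid : List ℕ → Prop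
  | [] => True
  | e :: E => e < 4 ∧ Inner E

theorem Inner.valid {E : List ℕ} (h : Inner E) : NValid E := by
  cases E with
  | nil => trivial
  | cons e E =>
    refine ⟨?_, fun x hx => h x (List.mem_cons_of_mem _ hx)⟩
    have := h e List.mem_cons_self
    omega

theorem nf_mulA (E : List ℕ) (k : ℕ) (hE : NValid E) :
    ∃ E' k', NValid E' ∧ sA * (nfW E * sA ^ k) = nfW E' * sA ^ k' := by
  cases E with
  | nil => exact ⟨[], k + 1, trivial, by simp [nfW, pow_succ']⟩
  | cons e E =>
    obtain ⟨he, hi⟩ := hE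
    by_cases h3 : e = 3
    · subst h3
      refine ⟨0 :: E, 4 + k, ⟨by omega, hi⟩, ?_⟩
      simp only [nfW, pow_zero, one_mul]
      calc sA * (sA ^ 3 * sB * nfW E * sA ^ k) = sA ^ 4 * (sB * nfW E) * sA ^ k := by
            rw [pow_succ' sA 3]; simp only [mul_assoc]
        _ = _ := by rw [s_A4_comm, pow_add]; simp only [mul_assoc]
    · refine ⟨(e + 1) :: E, k, ⟨by omega, hi⟩, ?_⟩
      simp only [nfW, pow_succ' sA e, mul_assoc]

theorem nf_mulB (E : List ℕ) (k : ℕ) (hE : NValid E) :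
    (∃ E' k', NValid E' ∧ sB * (nfW E * sA ^ k) = nfW E' * sA ^ k') ∧
    ((¬ ∃ t, nfW E * sA ^ k = sA ^ 2 * t) → NValid (0 :: E)) := by
  cases E with
  | nil =>
    exact ⟨⟨[0], k, ⟨by omega, by simp [Inner]⟩, by simp [nfW]⟩,
      fun _ => ⟨by omega, by simp [Inner]⟩⟩
  | cons e E =>
    obtain ⟨he, hi⟩ := hE
    by_cases h2 : e = 2
    · subst h2
      constructor
      · have h0 : sB * (nfW (2 :: E) * sA ^ k) = sA ^ 2 * (nfW E * sA ^ k) := by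
          simp only [nfW]
          conv_rhs => rw [← s_rel]
          simp only [mul_assoc]
        rw [h0]
        cases E with
        | nil => exact ⟨[], 2 + k, trivial, by simp [nfW, pow_add]⟩
        | cons e E =>
          have hi' : Inner E := fun x hx => hi x (List.mem_cons_of_mem _ hx)
          rcases hi e List.mem_cons_self with rfl | rfl | rfl
          · exact ⟨2 :: E, k, ⟨by omega, hi'⟩, by simp [nfW, mul_assoc]⟩
          · exact ⟨3 :: E, k, ⟨by omega, hi'⟩, by simp [nfW, mul_assoc, pow_succ]⟩
          · refine ⟨1 :: E, 4 + k, ⟨by omega, hi'⟩, ?_⟩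
            simp only [nfW]
            calc sA ^ 2 * (sA ^ 3 * sB * nfW E * sA ^ k)
                = sA ^ 4 * (sA ^ 1 * sB * nfW E) * sA ^ k := by
                  simp only [← mul_assoc, ← pow_add]
              _ = _ := by rw [s_A4_comm, pow_add]; simp only [mul_assoc]
      · intro h
        exact absurd ⟨sB * nfW E * sA ^ k, by simp only [nfW, mul_assoc]⟩ h
    · have hv : NValid (0 :: e :: E) := by
        refine ⟨by omega, ?_⟩
        intro x hx
        rcases List.mem_cons.1 hx with rfl | hx
        · omega
        · exact hi x hx
      exact ⟨⟨0 :: e :: E, k, hv, by simp [nfW, mul_assoc]⟩, fun _ => hv⟩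

theorem nf_exists (s : PresentedS) : ∃ E k, NValid E ∧ s = nfW E * sA ^ k := by
  induction s using s_ind with
  | h1 => exact ⟨[], 0, trivial, by simp [nfW]⟩
  | hA s ih =>
    obtain ⟨E, k, hE, rfl⟩ := ih
    exact nf_mulA E k hE
  | hB s ih =>
    obtain ⟨E, k, hE, rfl⟩ := ih
    exact (nf_mulB E k hE).1

theorem bfun_floor (q : ℚ) (h : ⌊q⌋ % 4 ≠ 2) : ⌊bfun q⌋ % 4 = 0 := by
  obtain ⟨m, ⟨h1, h2⟩ | ⟨h1, h2⟩⟩ := b_cases q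
  · have : ⌊bfun q⌋ = 4 * m := by
      rw [bfun_lo q m h1 h2, Int.floor_eq_iff]
      push_cast
      constructor <;> linarith
    omega
  · have : ⌊q⌋ = 4 * m + 2 := by
      rw [Int.floor_eq_iff]
      push_cast
      constructor <;> linarith
    omega

theorem nf_floor (E : List ℕ) (k : ℕ) (q : ℤ) (hq : (q + k) % 4 ≠ 2) :
    ∀ e : ℕ, e < 4 → Inner E → ⌊sAct (nfW (e :: E) * sA ^ k) q⌋ % 4 = e := by
  induction E with
  | nil =>
    intro e he _
    simp only [nfW, map_mul, Equiv.Perm.mul_apply, sAct_A, sAct_B, mul_one]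
    have h := bfun_floor ((q : ℚ) + k) (by
      rw [show ((q : ℚ) + k) = ((q + k : ℤ) : ℚ) by push_cast; rfl, Int.floor_intCast]; exact hq)
    rw [Int.floor_add_natCast]; omega
  | cons e' E ih =>
    intro e he hi
    have h1 := hi e' List.mem_cons_self
    have h := ih e' (by omega) (fun x hx => hi x (List.mem_cons_of_mem _ hx))
    have h2 := bfun_floor (sAct (nfW (e' :: E) * sA ^ k) q) (by omega)
    rw [nfW, mul_assoc, mul_assoc, map_mul, map_mul, Equiv.Perm.mul_apply, Equiv.Perm.mul_apply,
      sAct_A, sAct_B, Int.floor_add_natCast]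
    omega

theorem nf_unique_aux (e : ℕ) (E : List ℕ) (k k' : ℕ) (he : e < 4) (hi : Inner E)
    (h : sAct (nfW (e :: E) * sA ^ k) = sAct (nfW [] * sA ^ k')) : False := by
  have h1 := nf_floor E k (-k) (by omega) e he hi
  have h2 := nf_floor E k (1 - k) (by omega) e he hi
  rw [h] at h1 h2
  simp only [nfW, one_mul, sAct_A, Int.floor_add_natCast, Int.floor_intCast] at h1 h2
  omega

theorem nf_unique (E : List ℕ) : ∀ (E' : List ℕ) (k k' : ℕ), NValid E → NValid E' →
    sAct (nfW E * sA ^ k) = sAct (nfW E' * sA ^ k') → E = E' ∧ k = k' := by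
  induction E with
  | nil =>
    intro E' k k' _ h' h
    cases E' with
    | nil =>
      refine ⟨rfl, ?_⟩
      have := congrArg (fun f => f 0) h
      simp only [nfW, one_mul, sAct_A] at this
      have : (k : ℚ) = k' := by linarith
      exact_mod_cast this
    | cons e E => exact (nf_unique_aux e E k' k h'.1 h'.2 h.symm).elim
  | cons e E ih =>
    intro E' k k' hv hv' h
    cases E' with
    | nil => exact (nf_unique_aux e E k k' hv.1 hv.2 h).elim
    | cons e' E' =>
      obtain ⟨q, hq, hq'⟩ : ∃ q : ℤ, (q + k) % 4 ≠ 2 ∧ (q + k') % 4 ≠ 2 := by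
        by_cases h0 : ((-k : ℤ) + k') % 4 = 2
        · exact ⟨1 - k, by omega, by omega⟩
        · exact ⟨-k, by omega, by omega⟩
      have h1 := nf_floor E k q hq e hv.1 hv.2
      have h2 := nf_floor E' k' q hq' e' hv'.1 hv'.2
      rw [h, h2] at h1
      have : e' = e := by exact_mod_cast h1
      subst this
      simp only [nfW, mul_assoc, map_mul, mul_left_cancel_iff] at h
      simp only [← map_mul] at h
      obtain ⟨rfl, rfl⟩ := ih E' k k' hv.2.valid hv'.2.valid h
      exact ⟨rfl, rfl⟩

theorem sAct_injective : Function.Injective sAct := by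
  intro s t h
  obtain ⟨E, k, hE, rfl⟩ := nf_exists s
  obtain ⟨E', k', hE', rfl⟩ := nf_exists t
  obtain ⟨rfl, rfl⟩ := nf_unique E E' k k' hE hE' h
  rfl

instance : IsLeftCancelMul PresentedS where
  mul_left_cancel a b c h := sAct_injective (by
    have := congrArg sAct h
    simpa using this)

instance : IsRightCancelMul PresentedS where
  mul_right_cancel a b c h := sAct_injective (by
    have := congrArg sAct h
    simpa using this)

instance : TwoUniqueProds PresentedS := by
  let _ : LinearOrder PresentedS := LinearOrder.lift'
    (fun s => toLex (fun n : ℕ => sAct s ((Denumerable.eqv ℚ).symm n))) (by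
      intro s t h
      apply sAct_injective
      ext q
      have := congrFun (toLex.injective h) (Denumerable.eqv ℚ q)
      simpa using this)
  have : MulLeftStrictMono PresentedS := ⟨by
    intro m s t h
    obtain ⟨i, h1, h2⟩ := h
    refine ⟨i, fun j hj => ?_, ?_⟩
    · have := h1 j hj
      simp only [map_mul, Equiv.Perm.mul_apply] at this ⊢
      exact congrArg _ this
    · simp only [map_mul, Equiv.Perm.mul_apply]
      exact sAct_strictMono m h2⟩
  infer_instance

/-! ### Degree and length -/

/-- The degree in `a`. -/
def sDeg : PresentedS →* Multiplicative ℕ :=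
  sLift (Multiplicative.ofAdd 1) 1 (by simp) (by simp)

theorem sDeg_A : sDeg sA = Multiplicative.ofAdd 1 := sLift_A ..
theorem sDeg_B : sDeg sB = 1 := sLift_B ..

theorem sDeg_zero (s : PresentedS) (h : sDeg s = 1) : ∃ n : ℕ, s = sB ^ n := by
  induction s using s_ind with
  | h1 => exact ⟨0, by simp⟩
  | hA s ih =>
    exfalso
    rw [map_mul, sDeg_A] at h
    have := congrArg Multiplicative.toAdd h
    simp at this
  | hB s ih =>
    rw [map_mul, sDeg_B, one_mul] at h
    obtain ⟨n, rfl⟩ := ih h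
    exact ⟨n + 1, by rw [pow_succ']⟩

/-- The number of `b` in the normal form. -/
noncomputable def sLen (s : PresentedS) : ℕ := (nf_exists s).choose.length

theorem sLen_nf (E : List ℕ) (k : ℕ) (hE : NValid E) : sLen (nfW E * sA ^ k) = E.length := by
  obtain ⟨k', h1, h2⟩ := (nf_exists (nfW E * sA ^ k)).choose_spec
  have := (nf_unique _ _ _ _ hE h1 (congrArg sAct h2)).1
  unfold sLen
  rw [← this]

/-- Elements which are infinitely divisible by `b` on the left. -/
def InE (s : PresentedS) : Prop := ∃ n t, s = sB ^ n * sA ^ 2 * t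

theorem inE_mulB (s : PresentedS) : InE (sB * s) ↔ InE s := by
  constructor
  · rintro ⟨n, t, h⟩
    cases n with
    | zero =>
      refine ⟨0, sB * t, ?_⟩
      rw [pow_zero, one_mul, ← s_rel, mul_assoc, mul_assoc] at h
      have := mul_left_cancel h
      simp [this]
    | succ n =>
      refine ⟨n, t, ?_⟩
      rw [pow_succ', mul_assoc, mul_assoc] at h
      simpa [mul_assoc] using mul_left_cancel h
  · rintro ⟨n, t, rfl⟩
    exact ⟨n + 1, t, by rw [pow_succ' sB]; simp only [mul_assoc]⟩

theorem sLen_mulB (s : PresentedS) (h : ¬ InE s) : sLen (sB * s) = sLen s + 1 := by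
  obtain ⟨E, k, hE, rfl⟩ := nf_exists s
  have hv := (nf_mulB E k hE).2 (fun ⟨t, ht⟩ => h ⟨0, t, by simpa using ht⟩)
  have : sB * (nfW E * sA ^ k) = nfW (0 :: E) * sA ^ k := by simp [nfW, mul_assoc]
  rw [this, sLen_nf _ _ hv, sLen_nf _ _ hE]
  simp

theorem not_inE_one : ¬ InE 1 := by
  rintro ⟨n, t, h⟩
  have := congrArg (fun s => Multiplicative.toAdd (sDeg s)) h
  simp [sDeg_A] at this
  omega

/-! ### The monoid algebra -/

section Alg

open Polynomial

variable (K : Type*) [Field K]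

theorem e_rel : eB K * eA K ^ 2 * eB K = eA K ^ 2 := by
  unfold eA eB
  rw [← map_pow, ← map_mul, ← map_mul, s_rel]

theorem e_rel2 : eA K ^ 4 * eB K = eB K * eA K ^ 4 := by
  unfold eA eB
  rw [← map_pow, ← map_mul, ← map_mul, s_rel2]

theorem e_pow_rel (n : ℕ) : eA K ^ 2 = eB K ^ n * eA K ^ 2 * eB K ^ n := by
  unfold eA eB
  rw [← map_pow, ← map_pow, ← map_mul, ← map_mul, ← s_pow_rel]

theorem of_ne_zero' (s : PresentedS) : MonoidAlgebra.of K PresentedS s ≠ 0 := by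
  rw [MonoidAlgebra.of_apply]
  intro h
  rw [MonoidAlgebra.single_eq_zero] at h
  exact one_ne_zero h

instance : IsDomain (MonoidAlgebra K PresentedS) := NoZeroDivisors.to_isDomain _

/-- The augmentation killing `a` and `b`. -/
noncomputable def eAug : MonoidAlgebra K PresentedS →ₐ[K] K :=
  MonoidAlgebra.lift K K PresentedS (sLift 0 0 (by simp) (by simp))

theorem eAug_A : eAug K (eA K) = 0 := by
  unfold eAug eA
  rw [MonoidAlgebra.lift_of, sLift_A]

theorem eAug_B : eAug K (eB K) = 0 := by
  unfold eAug eB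
  rw [MonoidAlgebra.lift_of, sLift_B]

theorem eA_not_unit : ¬ IsUnit (eA K) := fun h => by
  have := h.map (eAug K)
  rw [eAug_A] at this
  exact not_isUnit_zero this

theorem eB_not_unit : ¬ IsUnit (eB K) := fun h => by
  have := h.map (eAug K)
  rw [eAug_B] at this
  exact not_isUnit_zero this

/-- The grading by the degree in `a`. -/
noncomputable def ePhi : MonoidAlgebra K PresentedS →ₐ[K] (MonoidAlgebra K PresentedS)[X] :=
  MonoidAlgebra.lift K _ PresentedS
    { toFun := fun s => monomial (Multiplicative.toAdd (sDeg s)) (MonoidAlgebra.of K PresentedS s)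
      map_one' := by rw [map_one sDeg, toAdd_one, map_one, monomial_zero_one]
      map_mul' := fun s t => by
        rw [monomial_mul_monomial, map_mul sDeg, toAdd_mul, map_mul] }

theorem ePhi_of (s : PresentedS) : ePhi K (MonoidAlgebra.of K PresentedS s) =
    monomial (Multiplicative.toAdd (sDeg s)) (MonoidAlgebra.of K PresentedS s) := by
  unfold ePhi
  rw [MonoidAlgebra.lift_of]; rfl

theorem eval_ePhi (f : MonoidAlgebra K PresentedS) : eval 1 (ePhi K f) = f := by
  induction f using MonoidAlgebra.induction_on with
  | of s => rw [ePhi_of, eval_monomial, one_pow, mul_one]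
  | add x y hx hy => rw [map_add, eval_add, hx, hy]
  | smul r x hx => rw [map_smul, eval_smul, hx]

theorem ePhi_coeff_zero (f : MonoidAlgebra K PresentedS) :
    ∃ p : K[X], (ePhi K f).coeff 0 = aeval (eB K) p := by
  induction f using MonoidAlgebra.induction_on with
  | of s =>
    rw [ePhi_of, coeff_monomial]
    split_ifs with h
    · obtain ⟨n, rfl⟩ := sDeg_zero s h
      exact ⟨X ^ n, by rw [map_pow, map_pow, aeval_X]; rfl⟩
    · exact ⟨0, by simp⟩
  | add x y hx hy =>
    obtain ⟨p, hp⟩ := hx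
    obtain ⟨q, hq⟩ := hy
    exact ⟨p + q, by rw [map_add, coeff_add, hp, hq, map_add]⟩
  | smul r x hx =>
    obtain ⟨p, hp⟩ := hx
    exact ⟨r • p, by rw [map_smul, coeff_smul, hp, map_smul]⟩

/-- The degree in `a`. -/
noncomputable def eDeg (f : MonoidAlgebra K PresentedS) : ℕ := (ePhi K f).natDegree

theorem ePhi_ne_zero {f : MonoidAlgebra K PresentedS} (hf : f ≠ 0) : ePhi K f ≠ 0 := by
  intro h
  have := eval_ePhi K f
  rw [h, eval_zero] at this
  exact hf this.symm

theorem eDeg_mul {f g : MonoidAlgebra K PresentedS} (hf : f ≠ 0) (hg : g ≠ 0) :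
    eDeg K (f * g) = eDeg K f + eDeg K g := by
  unfold eDeg
  rw [map_mul, natDegree_mul (ePhi_ne_zero K hf) (ePhi_ne_zero K hg)]

theorem eDeg_zero {f : MonoidAlgebra K PresentedS} (h : eDeg K f = 0) :
    ∃ p : K[X], f = aeval (eB K) p := by
  obtain ⟨p, hp⟩ := ePhi_coeff_zero K f
  refine ⟨p, ?_⟩
  rw [← hp]
  have h2 := eval_ePhi K f
  rw [eq_C_of_natDegree_eq_zero h, eval_C] at h2
  exact h2.symm

theorem eDeg_A : eDeg K (eA K) = 1 := by
  unfold eDeg eA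
  rw [ePhi_of, natDegree_monomial_eq _ (of_ne_zero' K _), sDeg_A]
  rfl

theorem eDeg_unit {f : MonoidAlgebra K PresentedS} (h : IsUnit f) : eDeg K f = 0 := by
  obtain ⟨g, hg⟩ := h.exists_right_inv
  have h1 : eDeg K (1 : MonoidAlgebra K PresentedS) = 0 := by
    unfold eDeg; rw [map_one, natDegree_one]
  have hf0 : f ≠ 0 := h.ne_zero
  have hg0 : g ≠ 0 := by rintro rfl; simp at hg
  have := eDeg_mul K hf0 hg0
  rw [hg, h1] at this
  omega

/-! ### Left divisibility by polynomials in `b` -/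

open Classical in
/-- The grading by the number of `b`, modulo the span of the elements in `InE`. -/
noncomputable def ePsi : MonoidAlgebra K PresentedS →+ (MonoidAlgebra K PresentedS)[X] :=
  MonoidAlgebra.liftNC (algebraMap K (MonoidAlgebra K PresentedS)[X] : K →+ _)
    (fun s => if InE s then 0 else monomial (sLen s) (MonoidAlgebra.of K PresentedS s))

open Classical in
theorem ePsi_single (s : PresentedS) (c : K) : ePsi K (MonoidAlgebra.single s c) =
    c • (if InE s then 0 else monomial (sLen s) (MonoidAlgebra.of K PresentedS s)) := by
  unfold ePsi
  rw [MonoidAlgebra.liftNC_single, Algebra.smul_def]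
  rfl

theorem ePsi_smul (c : K) (f : MonoidAlgebra K PresentedS) : ePsi K (c • f) = c • ePsi K f := by
  induction f using MonoidAlgebra.induction_linear with
  | zero => simp
  | add x y hx hy => rw [smul_add, map_add, hx, hy, map_add, smul_add]
  | single s r => rw [MonoidAlgebra.smul_single, ePsi_single, ePsi_single, smul_assoc]

theorem ePsi_mulB (f : MonoidAlgebra K PresentedS) :
    ePsi K (eB K * f) = monomial 1 (eB K) * ePsi K f := by
  induction f using MonoidAlgebra.induction_linear with
  | zero => simp
  | add x y hx hy => rw [mul_add, map_add, hx, hy, map_add, mul_add]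
  | single s r =>
    have : eB K * MonoidAlgebra.single s r = MonoidAlgebra.single (sB * s) r := by
      unfold eB
      rw [MonoidAlgebra.of_apply, MonoidAlgebra.single_mul_single, one_mul]
    rw [this, ePsi_single, ePsi_single, mul_smul_comm]
    by_cases h : InE s
    · rw [if_pos h, if_pos ((inE_mulB s).2 h), mul_zero]
    · rw [if_neg h, if_neg (fun h' => h ((inE_mulB s).1 h')), sLen_mulB s h,
        monomial_mul_monomial, map_mul, add_comm]
      rfl

theorem ePsi_pow (n : ℕ) (f : MonoidAlgebra K PresentedS) :
    ePsi K (eB K ^ n * f) = monomial 1 (eB K) ^ n * ePsi K f := by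
  induction n with
  | zero => simp
  | succ n ih => rw [pow_succ', mul_assoc, ePsi_mulB, ih, pow_succ', mul_assoc]

theorem ePsi_aeval (p : K[X]) (f : MonoidAlgebra K PresentedS) :
    ePsi K (aeval (eB K) p * f) =
      aeval (monomial 1 (eB K) : (MonoidAlgebra K PresentedS)[X]) p * ePsi K f := by
  induction p using Polynomial.induction_on' with
  | add p q hp hq => rw [map_add, add_mul, map_add, hp, hq, map_add, add_mul]
  | monomial n c =>
    rw [aeval_monomial, aeval_monomial, ← Algebra.smul_def, ← Algebra.smul_def, smul_mul_assoc,
      ePsi_smul, ePsi_pow, smul_mul_assoc]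

theorem aeval_coeff (p : K[X]) (m : ℕ) :
    (aeval (monomial 1 (eB K) : (MonoidAlgebra K PresentedS)[X]) p).coeff m =
      p.coeff m • eB K ^ m := by
  induction p using Polynomial.induction_on' with
  | add p q hp hq => rw [map_add, coeff_add, hp, hq, coeff_add, add_smul]
  | monomial n c =>
    rw [aeval_monomial, ← Algebra.smul_def, coeff_smul, monomial_pow, one_mul, coeff_monomial,
      coeff_monomial]
    split_ifs with h
    · rw [h]
    · simp

theorem eB_pow_ne_zero (m : ℕ) : eB K ^ m ≠ 0 := pow_ne_zero _ (of_ne_zero' K _)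

theorem aeval_natDegree {p : K[X]} (hp : p ≠ 0) :
    (aeval (monomial 1 (eB K) : (MonoidAlgebra K PresentedS)[X]) p) ≠ 0 ∧
    p.natDegree ≤ (aeval (monomial 1 (eB K) : (MonoidAlgebra K PresentedS)[X]) p).natDegree := by
  have h : (aeval (monomial 1 (eB K) : (MonoidAlgebra K PresentedS)[X]) p).coeff p.natDegree
      ≠ 0 := by
    rw [aeval_coeff]
    exact smul_ne_zero (by simpa using hp) (eB_pow_ne_zero K _)
  refine ⟨?_, le_natDegree_of_ne_zero h⟩
  intro h0
  rw [h0] at h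
  simp at h

theorem aeval_eB_ne_zero {p : K[X]} (hp : p ≠ 0) : aeval (eB K) p ≠ 0 := by
  intro h
  have h1 := ePsi_aeval K p 1
  rw [h, zero_mul, map_zero] at h1
  have h2 : ePsi K 1 ≠ 0 := by
    rw [MonoidAlgebra.one_def, ePsi_single, if_neg not_inE_one, one_smul]
    rw [Ne, monomial_eq_zero_iff]
    exact of_ne_zero' K _
  exact mul_ne_zero (aeval_natDegree K hp).1 h2 h1.symm

theorem aeval_eB_injective : Function.Injective (aeval (eB K) : K[X] →ₐ[K] _) := by
  rw [injective_iff_map_eq_zero]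
  intro p hp
  by_contra h
  exact aeval_eB_ne_zero K h hp

theorem ePsi_compl (f : MonoidAlgebra K PresentedS) :
    ∃ n h, f - eval 1 (ePsi K f) = eB K ^ n * eA K ^ 2 * h := by
  induction f using MonoidAlgebra.induction_linear with
  | zero => exact ⟨0, 0, by simp⟩
  | add x y hx hy =>
    obtain ⟨n, g, hg⟩ := hx
    obtain ⟨m, h, hh⟩ := hy
    refine ⟨n + m, eB K ^ m * g + eB K ^ n * h, ?_⟩
    have h1 : eB K ^ (n + m) * eA K ^ 2 * (eB K ^ m * g) = eB K ^ n * eA K ^ 2 * g := by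
      conv_rhs => rw [e_pow_rel K m]
      simp only [pow_add, mul_assoc]
    have h2 : eB K ^ (n + m) * eA K ^ 2 * (eB K ^ n * h) = eB K ^ m * eA K ^ 2 * h := by
      conv_rhs => rw [e_pow_rel K n]
      rw [add_comm]
      simp only [pow_add, mul_assoc]
    rw [mul_add, h1, h2, ← hg, ← hh, map_add, eval_add]
    abel
  | single s c =>
    rw [ePsi_single]
    by_cases h : InE s
    · obtain ⟨n, t, ht⟩ := id h
      refine ⟨n, MonoidAlgebra.single t c, ?_⟩
      rw [if_pos h, smul_zero, eval_zero, sub_zero]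
      unfold eA eB
      rw [← map_pow, ← map_pow, ← map_mul, MonoidAlgebra.of_apply,
        MonoidAlgebra.single_mul_single, one_mul, ht]
    · refine ⟨0, 0, ?_⟩
      rw [if_neg h, eval_smul, eval_monomial, one_pow, mul_one, mul_zero, MonoidAlgebra.of_apply,
        MonoidAlgebra.smul_single, smul_eq_mul, mul_one, sub_self]

theorem left_bound {f : MonoidAlgebra K PresentedS}
    (hf : ¬ ∃ n h, f = eB K ^ n * eA K ^ 2 * h) :
    ∃ N : ℕ, ∀ (p : K[X]) (h : MonoidAlgebra K PresentedS), f = aeval (eB K) p * h →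
      p.natDegree ≤ N := by
  have h0 : ePsi K f ≠ 0 := by
    intro h0
    obtain ⟨n, h, hh⟩ := ePsi_compl K f
    rw [h0, eval_zero, sub_zero] at hh
    exact hf ⟨n, h, hh⟩
  refine ⟨(ePsi K f).natDegree, ?_⟩
  rintro p h rfl
  rw [ePsi_aeval] at h0 ⊢
  have hp : p ≠ 0 := by rintro rfl; simp at h0
  rw [natDegree_mul (left_ne_zero_of_mul h0) (right_ne_zero_of_mul h0)]
  have := (aeval_natDegree K hp).2
  omega

/-! ### The reversal -/

/-- The reversal, as a map to the opposite algebra. -/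
noncomputable def eRevOp : MonoidAlgebra K PresentedS →ₐ[K] (MonoidAlgebra K PresentedS)ᵐᵒᵖ :=
  MonoidAlgebra.lift K _ PresentedS
    (sLift (MulOpposite.op (eA K)) (MulOpposite.op (eB K))
      (by
        apply MulOpposite.unop_injective
        simp only [MulOpposite.unop_mul, MulOpposite.unop_pow, MulOpposite.unop_op, ← mul_assoc,
          e_rel])
      (by
        apply MulOpposite.unop_injective
        simp only [MulOpposite.unop_mul, MulOpposite.unop_pow, MulOpposite.unop_op, e_rel2]))

/-- The reversal. -/
noncomputable def eRev (f : MonoidAlgebra K PresentedS) : MonoidAlgebra K PresentedS :=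
  MulOpposite.unop (eRevOp K f)

theorem eRev_A : eRev K (eA K) = eA K := by
  have : eRevOp K (eA K) = MulOpposite.op (eA K) := by
    change eRevOp K (MonoidAlgebra.of K PresentedS sA) = _
    unfold eRevOp
    rw [MonoidAlgebra.lift_of, sLift_A]
  unfold eRev
  rw [this, MulOpposite.unop_op]

theorem eRev_B : eRev K (eB K) = eB K := by
  have : eRevOp K (eB K) = MulOpposite.op (eB K) := by
    change eRevOp K (MonoidAlgebra.of K PresentedS sB) = _
    unfold eRevOp
    rw [MonoidAlgebra.lift_of, sLift_B]
  unfold eRev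
  rw [this, MulOpposite.unop_op]

theorem eRev_mul (f g : MonoidAlgebra K PresentedS) : eRev K (f * g) = eRev K g * eRev K f := by
  unfold eRev
  rw [map_mul, MulOpposite.unop_mul]

theorem eRev_add (f g : MonoidAlgebra K PresentedS) : eRev K (f + g) = eRev K f + eRev K g := by
  unfold eRev
  rw [map_add, MulOpposite.unop_add]

theorem eRev_one : eRev K 1 = 1 := by
  unfold eRev
  rw [map_one, MulOpposite.unop_one]

theorem eRev_smul (c : K) (f : MonoidAlgebra K PresentedS) : eRev K (c • f) = c • eRev K f := by
  unfold eRev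
  rw [map_smul, MulOpposite.unop_smul]

theorem eRev_pow (f : MonoidAlgebra K PresentedS) (n : ℕ) : eRev K (f ^ n) = eRev K f ^ n := by
  unfold eRev
  rw [map_pow, MulOpposite.unop_pow]

theorem eRev_aeval (p : K[X]) : eRev K (aeval (eB K) p) = aeval (eB K) p := by
  induction p using Polynomial.induction_on' with
  | add p q hp hq => rw [map_add, eRev_add, hp, hq]
  | monomial n c => rw [aeval_monomial, ← Algebra.smul_def, eRev_smul, eRev_pow, eRev_B]

theorem eRev_eRev (f : MonoidAlgebra K PresentedS) : eRev K (eRev K f) = f := by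
  induction f using MonoidAlgebra.induction_on with
  | of s =>
    induction s using s_ind with
    | h1 => rw [map_one, eRev_one, eRev_one]
    | hA s ih =>
      rw [map_mul, eRev_mul, eRev_mul, ih]
      change eRev K (eRev K (eA K)) * _ = _
      rw [eRev_A, eRev_A]; rfl
    | hB s ih =>
      rw [map_mul, eRev_mul, eRev_mul, ih]
      change eRev K (eRev K (eB K)) * _ = _
      rw [eRev_B, eRev_B]; rfl
  | add x y hx hy => rw [eRev_add, eRev_add, hx, hy]
  | smul r x hx => rw [eRev_smul, eRev_smul, hx]

theorem right_bound {f : MonoidAlgebra K PresentedS}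
    (hf : ¬ ∃ n h, f = h * (eA K ^ 2 * eB K ^ n)) :
    ∃ N : ℕ, ∀ (p : K[X]) (h : MonoidAlgebra K PresentedS), f = h * aeval (eB K) p →
      p.natDegree ≤ N := by
  obtain ⟨N, hN⟩ := left_bound K (f := eRev K f) (by
    rintro ⟨n, h, hh⟩
    refine hf ⟨n, eRev K h, ?_⟩
    have := congrArg (eRev K) hh
    rw [eRev_eRev, eRev_mul, eRev_mul, eRev_pow, eRev_pow, eRev_A, eRev_B] at this
    exact this)
  refine ⟨N, fun p h hh => hN p (eRev K h) ?_⟩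
  rw [hh, eRev_mul, eRev_aeval]

/-! ### Atomicity -/

/-- The submonoid generated by units and atoms. -/
noncomputable def atomMonoid : Submonoid (MonoidAlgebra K PresentedS) :=
  Submonoid.closure {x | IsUnit x ∨ Irreducible x}

theorem atomMonoid_spec {f : MonoidAlgebra K PresentedS} (hf : f ∈ atomMonoid K) :
    IsUnit f ∨ ∃ l : List (MonoidAlgebra K PresentedS), (∀ g ∈ l, Irreducible g) ∧ l.prod = f := by
  induction hf using Submonoid.closure_induction_left with
  | one => exact Or.inl isUnit_one
  | mul_left x hx y _ ih =>
    rcases hx with hx | hx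
    · rcases ih with hy | ⟨l, hl, rfl⟩
      · exact Or.inl (hx.mul hy)
      · cases l with
        | nil => left; simpa using hx
        | cons g l =>
          right
          refine ⟨(x * g) :: l, ?_, by simp [mul_assoc]⟩
          intro z hz
          rcases List.mem_cons.1 hz with rfl | hz
          · obtain ⟨u, rfl⟩ := hx
            exact (irreducible_units_mul u).2 (hl g List.mem_cons_self)
          · exact hl z (List.mem_cons_of_mem _ hz)
    · right
      rcases ih with hy | ⟨l, hl, rfl⟩
      · obtain ⟨u, rfl⟩ := hy
        exact ⟨[x * u], by simpa using (irreducible_mul_units u).2 hx, by simp⟩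
      · refine ⟨x :: l, ?_, by simp⟩
        intro z hz
        rcases List.mem_cons.1 hz with rfl | hz
        · exact hx
        · exact hl z hz

theorem aeval_irreducible {p : K[X]} (hp : Irreducible p) : Irreducible (aeval (eB K) p) := by
  have hp0 := aeval_eB_ne_zero K hp.ne_zero
  have key : ∀ q : K[X], IsUnit q → IsUnit (aeval (eB K) q) := fun q hq => hq.map _
  have deg0 : eDeg K (aeval (eB K) p) = 0 → ∀ g h, aeval (eB K) p = g * h →
      IsUnit g ∨ IsUnit h := by
    intro hd g h hgh
    rw [hgh] at hp0
    rw [hgh, eDeg_mul K (left_ne_zero_of_mul hp0) (right_ne_zero_of_mul hp0)] at hd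
    obtain ⟨q, rfl⟩ := eDeg_zero K (f := g) (by omega)
    obtain ⟨r, rfl⟩ := eDeg_zero K (f := h) (by omega)
    rw [← map_mul] at hgh
    rcases hp.isUnit_or_isUnit (aeval_eB_injective K hgh) with h | h
    · exact Or.inl (key _ h)
    · exact Or.inr (key _ h)
  have hB0 : eDeg K (eB K) = 0 := by
    unfold eDeg eB
    rw [ePhi_of, natDegree_monomial_eq _ (of_ne_zero' K _), sDeg_B]
    rfl
  have hd : ∀ q : K[X], eDeg K (aeval (eB K) q) = 0 := by
    intro q
    induction q using Polynomial.induction_on' with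
    | add p q hp hq =>
      unfold eDeg at *
      rw [map_add, map_add]
      have := natDegree_add_le (ePhi K (aeval (eB K) p)) (ePhi K (aeval (eB K) q))
      omega
    | monomial n c =>
      unfold eDeg at *
      rw [aeval_monomial, ← Algebra.smul_def, map_smul, map_pow]
      have h1 := natDegree_smul_le c (ePhi K (eB K) ^ n)
      have h2 := natDegree_pow_le (p := ePhi K (eB K)) (n := n)
      rw [hB0] at h2
      omega
  refine ⟨?_, fun {g h} => deg0 (hd p) g h⟩
  intro hu
  obtain ⟨g, hg⟩ := hu.exists_right_inv
  have hg0 : g ≠ 0 := by rintro rfl; simp at hg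
  have h1 := eDeg_mul K hp0 hg0
  rw [hg, eDeg_unit K isUnit_one] at h1
  obtain ⟨q, rfl⟩ := eDeg_zero K (f := g) (by omega)
  rw [← map_mul, ← map_one (aeval (eB K) : K[X] →ₐ[K] _)] at hg
  exact hp.not_isUnit (IsUnit.of_mul_eq_one _ (aeval_eB_injective K hg))

theorem aeval_mem (p : K[X]) (hp : p ≠ 0) : aeval (eB K) p ∈ atomMonoid K := by
  induction p using WfDvdMonoid.induction_on_irreducible with
  | zero => exact absurd rfl hp
  | unit u hu => exact Submonoid.subset_closure (Or.inl (hu.map _))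
  | mul a i ha hi ih =>
    rw [map_mul]
    exact mul_mem (Submonoid.subset_closure (Or.inr (aeval_irreducible K hi))) (ih ha)

theorem mem_atomMonoid (d : ℕ) : ∀ f : MonoidAlgebra K PresentedS, f ≠ 0 → eDeg K f = d →
    f ∈ atomMonoid K := by
  induction d using Nat.strong_induction_on with
  | _ d ih =>
  intro f hf hd
  have hA0 : eA K ≠ 0 := of_ne_zero' K _
  rcases Nat.eq_zero_or_pos d with rfl | hpos
  · obtain ⟨p, rfl⟩ := eDeg_zero K hd
    exact aeval_mem K p (by rintro rfl; simp at hf)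
  by_cases hsplit : ∃ g h, f = g * h ∧ 0 < eDeg K g ∧ 0 < eDeg K h
  · obtain ⟨g, h, rfl, h1, h2⟩ := hsplit
    have hg0 := left_ne_zero_of_mul hf
    have hh0 := right_ne_zero_of_mul hf
    rw [eDeg_mul K hg0 hh0] at hd
    exact mul_mem (ih _ (by omega) g hg0 rfl) (ih _ (by omega) h hh0 rfl)
  obtain ⟨N, hN⟩ := left_bound K (f := f) (by
    rintro ⟨n, h, rfl⟩
    refine hsplit ⟨eB K ^ n * eA K, eA K * h, by rw [pow_two]; simp only [mul_assoc], ?_, ?_⟩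
    · rw [eDeg_mul K (eB_pow_ne_zero K n) hA0, eDeg_A]; omega
    · rw [eDeg_mul K hA0 (right_ne_zero_of_mul hf), eDeg_A]; omega)
  obtain ⟨M, hM⟩ := right_bound K (f := f) (by
    rintro ⟨n, h, rfl⟩
    refine hsplit ⟨h * eA K, eA K * eB K ^ n, by rw [pow_two]; simp only [mul_assoc], ?_, ?_⟩
    · rw [eDeg_mul K (left_ne_zero_of_mul hf) hA0, eDeg_A]; omega
    · rw [eDeg_mul K hA0 (eB_pow_ne_zero K n), eDeg_A]; omega)
  -- descending induction on the total degree of the polynomial parts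
  have key : ∀ m : ℕ, ∀ (p q : K[X]) (g : MonoidAlgebra K PresentedS),
      f = aeval (eB K) p * g * aeval (eB K) q → N + M ≤ p.natDegree + q.natDegree + m →
      f ∈ atomMonoid K := by
    intro m
    induction m using Nat.strong_induction_on with
    | _ m ihm =>
    intro p q g hfg hm
    have hf' := hf
    rw [hfg] at hf'
    have hp0 : p ≠ 0 := by rintro rfl; simp at hf'
    have hq0 : q ≠ 0 := by rintro rfl; simp at hf'
    have hg0 : g ≠ 0 := by rintro rfl; simp at hf'
    have hpa := aeval_eB_ne_zero K hp0
    have hqa := aeval_eB_ne_zero K hq0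
    have unit_of : ∀ r : K[X], r ≠ 0 → ¬ IsUnit (aeval (eB K) r) → 0 < r.natDegree := by
      intro r hr hu
      by_contra hc
      apply hu
      refine IsUnit.map _ ?_
      rw [eq_C_of_natDegree_eq_zero (by omega : r.natDegree = 0)] at hr ⊢
      refine isUnit_C.2 (IsUnit.mk0 _ ?_)
      simpa using hr
    have hstep : ∀ p' q' : K[X], ∀ g', f = aeval (eB K) p' * g' * aeval (eB K) q' →
        p'.natDegree + q'.natDegree ≤ N + M := by
      intro p' q' g' h
      have h1 := hN p' (g' * aeval (eB K) q') (by rw [h, mul_assoc])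
      have h2 := hM q' (aeval (eB K) p' * g') h
      omega
    by_cases hgi : IsUnit g ∨ Irreducible g
    · rw [hfg]
      exact mul_mem (mul_mem (aeval_mem K p hp0) (Submonoid.subset_closure hgi))
        (aeval_mem K q hq0)
    · push Not at hgi
      obtain ⟨hgu, hgi⟩ := hgi
      rw [irreducible_iff] at hgi
      push Not at hgi
      obtain ⟨x, y, rfl, hx, hy⟩ := hgi hgu
      have hx0 := left_ne_zero_of_mul hg0
      have hy0 := right_ne_zero_of_mul hg0
      by_cases hdx : eDeg K x = 0
      · obtain ⟨r, rfl⟩ := eDeg_zero K hdx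
        have hr0 : r ≠ 0 := by rintro rfl; simp at hx0
        have hr := unit_of r hr0 hx
        have heq : f = aeval (eB K) (p * r) * y * aeval (eB K) q := by
          rw [hfg, map_mul]; simp only [mul_assoc]
        have hb := hstep _ _ _ heq
        have hnd := natDegree_mul hp0 hr0
        exact ihm (m - 1) (by omega) (p * r) q y heq (by omega)
      · by_cases hdy : eDeg K y = 0
        · obtain ⟨r, rfl⟩ := eDeg_zero K hdy
          have hr0 : r ≠ 0 := by rintro rfl; simp at hy0
          have hr := unit_of r hr0 hy
          have heq : f = aeval (eB K) p * x * aeval (eB K) (r * q) := by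
            rw [hfg, map_mul]; simp only [mul_assoc]
          have hb := hstep _ _ _ heq
          have hnd := natDegree_mul hr0 hq0
          exact ihm (m - 1) (by omega) p (r * q) x heq (by omega)
        · exfalso
          refine hsplit ⟨aeval (eB K) p * x, y * aeval (eB K) q, ?_, ?_, ?_⟩
          · rw [hfg]; simp only [mul_assoc]
          · rw [eDeg_mul K hpa hx0]; omega
          · rw [eDeg_mul K hy0 hqa]; omega
  exact key (N + M) 1 1 f (by simp) (by omega)

theorem not_BF : ¬ IsBFRing (MonoidAlgebra K PresentedS) := by
  rintro ⟨hat, hfin⟩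
  have hc : ∀ x : MonoidAlgebra K PresentedS, x ≠ 0 →
      x ∈ cancellativeSubmonoid (MonoidAlgebra K PresentedS) := fun x hx =>
    ⟨fun y z h => mul_left_cancel₀ hx h, fun y z h => mul_right_cancel₀ hx h⟩
  let b' : cancellativeSubmonoid (MonoidAlgebra K PresentedS) := ⟨eB K, hc _ (of_ne_zero' K _)⟩
  let a' : cancellativeSubmonoid (MonoidAlgebra K PresentedS) := ⟨eA K, hc _ (of_ne_zero' K _)⟩
  obtain ⟨lb, hlb, hpb⟩ := hat b' (fun h =>
    eB_not_unit K (h.map (cancellativeSubmonoid (MonoidAlgebra K PresentedS)).subtype))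
  obtain ⟨la, hla, hpa⟩ := hat a' (fun h =>
    eA_not_unit K (h.map (cancellativeSubmonoid (MonoidAlgebra K PresentedS)).subtype))
  have hlen : 0 < lb.length := by
    rcases lb with _ | ⟨x, l⟩
    · exfalso
      have h1 : b' = 1 := by rw [← hpb]; simp
      exact eB_not_unit K (by
        have := congrArg Subtype.val h1
        change eB K = 1 at this
        rw [this]; exact isUnit_one)
    · simp
  obtain ⟨B, hB⟩ := (hfin (a' ^ 2)).bddAbove
  let n := B + 1
  let l := (List.replicate n lb).flatten ++ (la ++ la) ++ (List.replicate n lb).flatten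
  have hprod : (List.replicate n lb).flatten.prod = b' ^ n := by
    rw [List.prod_flatten, List.map_replicate, List.prod_replicate, hpb]
  have hmem : l.length ∈ mulLengthSet (a' ^ 2) := by
    refine ⟨l, ?_, ?_, rfl⟩
    · intro x hx
      simp only [l, List.mem_append, List.mem_flatten, List.mem_replicate] at hx
      rcases hx with (⟨_, ⟨_, rfl⟩, hx⟩ | hx | hx) | ⟨_, ⟨_, rfl⟩, hx⟩
      · exact hlb x hx
      · exact hla x hx
      · exact hla x hx
      · exact hlb x hx
    · simp only [l, List.prod_append, hprod, hpa, ← pow_two]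
      exact Subtype.ext (e_pow_rel K n).symm
  have h1 := hB hmem
  have h2 : n * lb.length ≤ l.length := by
    simp only [l, List.length_append, List.length_flatten, List.map_replicate, List.sum_replicate,
      smul_eq_mul]
    omega
  have h3 : n * 1 ≤ n * lb.length := Nat.mul_le_mul_left _ hlen
  omega

end Alg

/-- Let `K` be a field, `S = ⟨a, b ∣ ba²b = a², a⁴b = ba⁴⟩` and
`R = K[S]` the monoid algebra.  Then (1) `R` is a domain; (2) `R` is atomic;
(3) `R` satisfies neither the ACC on principal right ideals — indeed
`a²R ⊊ ba²R ⊊ b²a²R ⊊ ⋯` is strictly ascending — nor the ACC on principal left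
ideals; in particular (since `a² = bⁿa²bⁿ` for all `n`, so the length set of `a²`
is infinite) `R` is not a BF-domain. -/
theorem presentedMonoidAlgebra_atomic_not_ACCP (K : Type*) [Field K] :
    IsDomain (MonoidAlgebra K PresentedS) ∧
    (∀ f : MonoidAlgebra K PresentedS, f ≠ 0 → ¬ IsUnit f →
      ∃ l : List (MonoidAlgebra K PresentedS),
        (∀ g ∈ l, Irreducible g) ∧ l.prod = f) ∧
    (∀ n : ℕ,
      (∃ r : MonoidAlgebra K PresentedS,
        eB K ^ n * eA K ^ 2 = eB K ^ (n + 1) * eA K ^ 2 * r) ∧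
      ¬ ∃ r : MonoidAlgebra K PresentedS,
        eB K ^ (n + 1) * eA K ^ 2 = eB K ^ n * eA K ^ 2 * r) ∧
    (∀ n : ℕ,
      (∃ r : MonoidAlgebra K PresentedS,
        eA K ^ 2 * eB K ^ n = r * (eA K ^ 2 * eB K ^ (n + 1))) ∧
      ¬ ∃ r : MonoidAlgebra K PresentedS,
        eA K ^ 2 * eB K ^ (n + 1) = r * (eA K ^ 2 * eB K ^ n)) ∧
    (∀ n : ℕ, sA ^ 2 = sB ^ n * sA ^ 2 * sB ^ n) ∧
    ¬ IsBFRing (MonoidAlgebra K PresentedS) := by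
  have hA0 : eA K ≠ 0 := of_ne_zero' K _
  refine ⟨inferInstance, ?_, ?_, ?_, s_pow_rel, not_BF K⟩
  · intro f hf hu
    exact (atomMonoid_spec K (mem_atomMonoid K _ f hf rfl)).resolve_left hu
  · intro n
    have h0 : eB K ^ (n + 1) * eA K ^ 2 * eB K = eB K ^ n * eA K ^ 2 := by
      rw [pow_succ, mul_assoc, mul_assoc, ← mul_assoc (eB K) (eA K ^ 2), e_rel]
    refine ⟨⟨eB K, h0.symm⟩, ?_⟩
    rintro ⟨r, hr⟩
    rw [hr, mul_assoc] at h0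
    have h1 : r * eB K = 1 :=
      mul_left_cancel₀ (mul_ne_zero (eB_pow_ne_zero K n) (pow_ne_zero 2 hA0)) (by rw [h0, mul_one])
    have h2 := congrArg (eAug K) h1
    rw [map_mul, eAug_B, mul_zero, map_one] at h2
    exact zero_ne_one h2
  · intro n
    have h0 : eB K * (eA K ^ 2 * eB K ^ (n + 1)) = eA K ^ 2 * eB K ^ n := by
      rw [pow_succ' (eB K), ← mul_assoc, ← mul_assoc, e_rel]
    refine ⟨⟨eB K, h0.symm⟩, ?_⟩
    rintro ⟨r, hr⟩
    rw [hr, ← mul_assoc] at h0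
    have h1 : eB K * r = 1 :=
      mul_right_cancel₀ (mul_ne_zero (pow_ne_zero 2 hA0) (eB_pow_ne_zero K n)) (by rw [h0, one_mul])
    have h2 := congrArg (eAug K) h1
    rw [map_mul, eAug_B, zero_mul, map_one] at h2
    exact zero_ne_one h2

end PaperExample
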